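/- arXiv:1107.0060 — 7 statements merged into one kernel-verified Lean document; each statement's English description precedes it below -/
import Mathlib

section
/- Let $T$ be a tree with $n$ vertices and let $m$ be an integer with $1 < m < n$. Then the number of proper-in-the-degree-sense colorings satisfies $P_m(T,k) = k^n - \sum_{v \in V(T)} \binom{d(v)}{m} k^{n-m} + o(k^{n-m})$ as $k \to \infty$; that is, the function $k \mapsto P_m(T,k) - k^n + \left(\sum_{v \in V(T)} \binom{d(v)}{m}\right) k^{n-m}$ is $o(k^{n-m})$. -/
open Finset Filter Asymptotics

/-- The number of neighbors of `v` that get the same color as `v` under `σ`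
    ("friends" of `v`). -/
def friendCount {V : Type*} [Fintype V] (G : SimpleGraph V) [DecidableRel G.Adj]
    {k : ℕ} (σ : V → Fin k) (v : V) : ℕ :=
  ((G.neighborFinset v).filter (fun w => σ w = σ v)).card

/-- The degree chromatic count `P_m(G,k)`: the number of `k`-colorings such that
    no vertex has `m` or more neighbors of its own color. -/
def degChromCount {V : Type*} [Fintype V] [DecidableEq V] (G : SimpleGraph V)
    [DecidableRel G.Adj] (m k : ℕ) : ℕ :=
  (Finset.univ.filter (fun σ : V → Fin k => ∀ v, friendCount G σ v < m)).card

/-- A truncated Bonferroni inequality with a uniform bound on pairwise intersections. -/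
lemma Finset.sum_card_le_card_biUnion_add {ι α : Type*} [DecidableEq ι] [DecidableEq α]
    (I : Finset ι) (E : ι → Finset α) (c : ℕ)
    (h : ∀ i ∈ I, ∀ j ∈ I, i ≠ j → (E i ∩ E j).card ≤ c) :
    ∑ i ∈ I, (E i).card ≤ (I.biUnion E).card + I.card ^ 2 * c := by
  induction I using Finset.induction_on with
  | empty => simp
  | insert a I ha ih =>
    have ih' := ih fun i hi j hj =>
      h i (mem_insert_of_mem hi) j (mem_insert_of_mem hj)
    have hinter : (E a ∩ I.biUnion E).card ≤ I.card * c := by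
      rw [inter_biUnion]
      refine card_biUnion_le_card_mul _ _ _ fun j hj => ?_
      exact h a (mem_insert_self _ _) j (mem_insert_of_mem hj) (by rintro rfl; exact ha hj)
    have hunion := card_union_add_card_inter (E a) (I.biUnion E)
    rw [sum_insert ha, biUnion_insert, card_insert_of_notMem ha]
    nlinarith

section Stars

variable {V : Type*} [Fintype V]

/-- The `m`-edge stars of `G`, each given by its center and its set of leaves. -/
def stars (G : SimpleGraph V) [DecidableRel G.Adj] (m : ℕ) : Finset (Σ _ : V, Finset V) :=
  univ.sigma fun v => powersetCard m (G.neighborFinset v)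

variable (G : SimpleGraph V) [DecidableRel G.Adj] {m : ℕ}

lemma mem_stars {p : Σ _ : V, Finset V} :
    p ∈ stars G m ↔ p.2 ⊆ G.neighborFinset p.1 ∧ p.2.card = m := by
  simp [stars, mem_powersetCard]

lemma card_stars : (stars G m).card = ∑ v, (G.degree v).choose m := by
  simp [stars, card_sigma]

variable {G}

lemma center_notMem_of_mem_stars {p : Σ _ : V, Finset V} (hp : p ∈ stars G m) :
    p.1 ∉ p.2 := fun h => by
  simpa using ((mem_stars G).1 hp).1 h

end Stars

section Colorings

variable {V : Type*} [Fintype V] [DecidableEq V]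

/-- The colorings that give every vertex of `S` the color of `v`. -/
def constantColorings (k : ℕ) (v : V) (S : Finset V) : Finset (V → Fin k) :=
  univ.filter fun σ => ∀ w ∈ S, σ w = σ v

lemma mem_constantColorings {k : ℕ} {v : V} {S : Finset V} {σ : V → Fin k} :
    σ ∈ constantColorings k v S ↔ ∀ w ∈ S, σ w = σ v := by
  simp [constantColorings]

/-- A family of colorings determined by their values off `S` has at most `k ^ (|V| - |S|)`
members. -/
lemma card_colorings_le_pow {k : ℕ} (F : Finset (V → Fin k)) (S : Finset V)
    (h : ∀ σ ∈ F, ∀ τ ∈ F, (∀ x ∉ S, σ x = τ x) → σ = τ) :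
    F.card ≤ k ^ (Fintype.card V - S.card) := by
  have hcard : (univ : Finset ({x // x ∉ S} → Fin k)).card = k ^ (Fintype.card V - S.card) := by
    simp [Fintype.card_subtype_compl]
  rw [← hcard]
  refine card_le_card_of_injOn (fun σ x => σ x) (fun _ _ => mem_coe.2 (mem_univ _)) ?_
  intro σ hσ τ hτ hστ
  exact h σ hσ τ hτ fun x hx => congrFun hστ ⟨x, hx⟩

lemma card_constantColorings (k : ℕ) {v : V} {S : Finset V} (hv : v ∉ S) :
    (constantColorings k v S).card = k ^ (Fintype.card V - S.card) := by
  apply le_antisymm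
  · refine card_colorings_le_pow _ S fun σ hσ τ hτ h => funext fun x => ?_
    rw [mem_constantColorings] at hσ hτ
    by_cases hx : x ∈ S
    · rw [hσ x hx, hτ x hx, h v hv]
    · exact h x hx
  · have hcard : (univ : Finset ({x // x ∉ S} → Fin k)).card =
        k ^ (Fintype.card V - S.card) := by
      simp [Fintype.card_subtype_compl]
    rw [← hcard]
    refine card_le_card_of_injOn
      (fun f x => if hx : x ∉ S then f ⟨x, hx⟩ else f ⟨v, hv⟩) ?_ ?_
    · intro f _
      rw [mem_coe, mem_constantColorings]
      intro w hw
      simp [hw, hv]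
    · intro f _ g _ hfg
      funext ⟨x, hx⟩
      simpa [hx] using congrFun hfg x

lemma card_constantColorings_inter_le (k : ℕ) {v w : V} {S S' : Finset V} (hv : v ∉ S)
    (hw : w ∉ S') (hS' : 0 < S'.card) (hne : ¬ insert w S' ⊆ insert v S) :
    (constantColorings k v S ∩ constantColorings k w S').card ≤
      k ^ (Fintype.card V - (S.card + 1)) := by
  obtain ⟨x, hx, hxS⟩ := not_subset.1 hne
  obtain ⟨y, hy, hyx⟩ : ∃ y ∈ insert w S', y ≠ x :=
    exists_mem_ne (by rw [card_insert_of_notMem hw]; omega) x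
  have hxv : v ≠ x := by rintro rfl; exact hxS (mem_insert_self _ _)
  have hxS0 : x ∉ S := fun h => hxS (mem_insert_of_mem h)
  rw [← card_insert_of_notMem hxS0]
  refine card_colorings_le_pow _ _ fun σ hσ τ hτ h => ?_
  simp only [mem_inter, mem_constantColorings] at hσ hτ
  have hoff : ∀ z, z ≠ x → σ z = τ z := by
    intro z hz
    by_cases hzS : z ∈ S
    · rw [hσ.1 z hzS, hτ.1 z hzS, h v (by simp [hv, hxv])]
    · exact h z (by simp [hz, hzS])
  have hconst : ∀ ρ : V → Fin k, (∀ z ∈ S', ρ z = ρ w) → ρ x = ρ y := by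
    intro ρ hρ
    have hρ' : ∀ z ∈ insert w S', ρ z = ρ w := by simpa using hρ
    rw [hρ' x hx, hρ' y hy]
  funext z
  by_cases hz : z = x
  · rw [hz, hconst σ hσ.2, hconst τ hτ.2, hoff y hyx]
  · exact hoff z hz

variable {G : SimpleGraph V} [DecidableRel G.Adj] {m : ℕ}

/-- In a triangle-free graph, stars with at least two edges are determined by their vertices. -/
lemma eq_of_insert_subset_insert_of_mem_stars (hG : G.CliqueFree 3) (hm : 1 < m)
    {p q : Σ _ : V, Finset V} (hp : p ∈ stars G m) (hq : q ∈ stars G m)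
    (h : insert q.1 q.2 ⊆ insert p.1 p.2) : p = q := by
  have hpc := center_notMem_of_mem_stars hp
  have hqc := center_notMem_of_mem_stars hq
  obtain ⟨v, S⟩ := p
  obtain ⟨w, S'⟩ := q
  rw [mem_stars] at hp hq
  obtain ⟨hS, hSm⟩ := hp
  obtain ⟨hS', hSm'⟩ := hq
  dsimp only at *
  have heq : insert w S' = insert v S := eq_of_subset_of_card_le h (by
    rw [card_insert_of_notMem hpc, card_insert_of_notMem hqc, hSm, hSm'])
  by_cases hvw : v = w
  · subst hvw
    have : S = S' := by
      rw [← erase_insert hpc, ← erase_insert hqc, heq]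
    rw [this]
  · exfalso
    obtain ⟨u, hu, huw⟩ := exists_mem_ne (hSm ▸ hm) w
    have hwS : w ∈ S := by
      have : w ∈ insert v S := heq ▸ mem_insert_self _ _
      exact (mem_insert.1 this).resolve_left (Ne.symm hvw)
    have huS' : u ∈ S' := by
      have : u ∈ insert w S' := heq ▸ mem_insert_of_mem hu
      exact (mem_insert.1 this).resolve_left huw
    have hvu := (G.mem_neighborFinset v u).1 (hS hu)
    have hvw' := (G.mem_neighborFinset v w).1 (hS hwS)
    have hwu := (G.mem_neighborFinset w u).1 (hS' huS')
    exact hG {v, u, w} (SimpleGraph.is3Clique_triple_iff.2 ⟨hvu, hvw', hwu.symm⟩)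

variable (G)

lemma degChromCount_add_card_biUnion (m k : ℕ) :
    degChromCount G m k + ((stars G m).biUnion fun p => constantColorings k p.1 p.2).card =
      k ^ Fintype.card V := by
  have hbad : ((stars G m).biUnion fun p => constantColorings k p.1 p.2) =
      univ.filter fun σ : V → Fin k => ¬ ∀ v, friendCount G σ v < m := by
    ext σ
    simp only [mem_biUnion, mem_stars, mem_constantColorings, mem_filter, mem_univ, true_and,
      not_forall, not_lt, Sigma.exists]
    refine exists_congr fun v => ⟨?_, fun h => ?_⟩
    · rintro ⟨S, ⟨hS, rfl⟩, hσ⟩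
      exact card_le_card fun w hw => mem_filter.2 ⟨hS hw, hσ w hw⟩
    · obtain ⟨S, hS, hSm⟩ := exists_subset_card_eq h
      exact ⟨S, ⟨hS.trans (filter_subset _ _), hSm⟩, fun w hw => (mem_filter.1 (hS hw)).2⟩
  rw [hbad, degChromCount, card_filter_add_card_filter_not]
  simp

end Colorings

theorem degree_chromatic_leading_terms {V : Type*} [Fintype V] [DecidableEq V]
    (T : SimpleGraph V) [DecidableRel T.Adj] (hT : T.IsTree)
    (n m : ℕ) (hn : Fintype.card V = n) (hm1 : 1 < m) (hmn : m < n) :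
    (fun k : ℕ => (degChromCount T m k : ℝ) - (k : ℝ) ^ n
        + (∑ v : V, ((T.degree v).choose m : ℝ)) * (k : ℝ) ^ (n - m))
      =o[atTop] fun k : ℕ => (k : ℝ) ^ (n - m) := by
  subst hn
  have hfree : T.CliqueFree 3 := hT.isAcyclic.cliqueFree le_rfl
  have hcard : ∀ k, ∀ p ∈ stars T m,
      (constantColorings k p.1 p.2).card = k ^ (Fintype.card V - m) := fun k p hp => by
    rw [card_constantColorings k (center_notMem_of_mem_stars hp), ((mem_stars T).1 hp).2]
  have hsum : ∀ k, ∑ p ∈ stars T m, (constantColorings k p.1 p.2).card =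
      (∑ v, (T.degree v).choose m) * k ^ (Fintype.card V - m) := fun k => by
    rw [sum_congr rfl (hcard k), sum_const, smul_eq_mul, card_stars]
  have hbound : ∀ k : ℕ, ‖(degChromCount T m k : ℝ) - (k : ℝ) ^ Fintype.card V
      + (∑ v : V, ((T.degree v).choose m : ℝ)) * (k : ℝ) ^ (Fintype.card V - m)‖ ≤
      ((stars T m).card ^ 2 : ℝ) * ‖(k : ℝ) ^ (Fintype.card V - (m + 1))‖ := by
    intro k
    have hcount := degChromCount_add_card_biUnion T m k
    have hupper : _ ≤ _ := card_biUnion_le (s := stars T m)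
      (t := fun p => constantColorings k p.1 p.2)
    have hlower := sum_card_le_card_biUnion_add (stars T m)
      (fun p => constantColorings k p.1 p.2) (k ^ (Fintype.card V - (m + 1))) (by
        intro p hp q hq hpq
        have := card_constantColorings_inter_le k (center_notMem_of_mem_stars hp)
          (center_notMem_of_mem_stars hq) (by rw [((mem_stars T).1 hq).2]; omega)
          (fun h => hpq (eq_of_insert_subset_insert_of_mem_stars hfree hm1 hp hq h))
        rwa [((mem_stars T).1 hp).2] at this)
    rw [hsum] at hupper hlower
    rify at hcount hupper hlower
    rw [Real.norm_of_nonneg (by positivity : (0 : ℝ) ≤ (k : ℝ) ^ (Fintype.card V - (m + 1))),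
      Real.norm_eq_abs, abs_le]
    have : (0 : ℝ) ≤ ((stars T m).card : ℝ) ^ 2 * (k : ℝ) ^ (Fintype.card V - (m + 1)) := by
      positivity
    constructor <;> linarith
  refine (IsBigO.of_bound _ (Eventually.of_forall hbound)).trans_isLittleO ?_
  exact (isLittleO_pow_pow_atTop_of_lt (𝕜 := ℝ) (by omega)).comp_tendsto
    tendsto_natCast_atTop_atTop
end

section
/- Let $T$ be a tree with $n$ vertices, let $v$ be a vertex of $T$, and let $m$ be an integer with $1 \le m < n$. Then $|A_v(k)| = \binom{d(v)}{m} k^{n-m} + o(k^{n-m})$ as $k \to \infty$; that is, $k \mapsto |A_v(k)| - \binom{d(v)}{m} k^{n-m}$ is $o(k^{n-m})$. -/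
open Finset Filter Asymptotics

/-- `A_v(k)`: the set of `k`-colorings in which `v` has at least `m` friends. -/
def Aset {V : Type*} [Fintype V] [DecidableEq V] (G : SimpleGraph V)
    [DecidableRel G.Adj] (m k : ℕ) (v : V) : Finset (V → Fin k) :=
  Finset.univ.filter (fun σ => m ≤ friendCount G σ v)

/-- If `v ∉ S`, the colorings that give every vertex of `S` the color of `v` are determined by
their restriction to the complement of `S`. -/
lemma card_filter_forall_eq {V : Type*} [Fintype V] [DecidableEq V] (k : ℕ) {v : V}
    {S : Finset V} (hv : v ∉ S) :
    #{σ : V → Fin k | ∀ w ∈ S, σ w = σ v} = k ^ (Fintype.card V - #S) := by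
  have hcard : #(univ : Finset ((Sᶜ : Finset V) → Fin k)) = k ^ (Fintype.card V - #S) := by
    simp [Finset.card_univ]
  rw [← hcard]
  refine Finset.card_bij' (fun σ _ w => σ w)
    (fun τ _ w => if h : w ∈ S then τ ⟨v, mem_compl.2 hv⟩ else τ ⟨w, mem_compl.2 h⟩)
    (fun _ _ => mem_univ _) ?_ ?_ ?_
  · intro τ _
    simp +contextual [hv]
  · intro σ hσ
    ext1 w
    by_cases h : w ∈ S
    · simp [h, (mem_filter.1 hσ).2 w h]
    · simp [h]
  · intro τ _
    ext1 w
    simp [mem_compl.1 w.2]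

/-- Double counting of pairs of a coloring and a set of `m` friends of `v`. -/
lemma sum_friendCount_choose {V : Type*} [Fintype V] [DecidableEq V] (G : SimpleGraph V)
    [DecidableRel G.Adj] (v : V) (m k : ℕ) :
    ∑ σ : V → Fin k, (friendCount G σ v).choose m
      = (G.degree v).choose m * k ^ (Fintype.card V - m) := by
  have hchoose (σ : V → Fin k) : (friendCount G σ v).choose m
      = #{S ∈ powersetCard m (G.neighborFinset v) | ∀ w ∈ S, σ w = σ v} := by
    rw [friendCount, ← card_powersetCard]
    congr 1
    ext S
    simp only [mem_powersetCard, mem_filter, subset_iff]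
    grind
  calc ∑ σ : V → Fin k, (friendCount G σ v).choose m
      = ∑ S ∈ powersetCard m (G.neighborFinset v), #{σ : V → Fin k | ∀ w ∈ S, σ w = σ v} := by
        simp_rw [hchoose, card_filter]
        exact sum_comm
    _ = ∑ S ∈ powersetCard m (G.neighborFinset v), k ^ (Fintype.card V - m) := by
        refine sum_congr rfl fun S hS => ?_
        obtain ⟨hsub, hcard⟩ := mem_powersetCard.1 hS
        have hv : v ∉ S := fun h => G.notMem_neighborFinset_self v (hsub h)
        rw [card_filter_forall_eq k hv, hcard]
    _ = (G.degree v).choose m * k ^ (Fintype.card V - m) := by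
        rw [sum_const, card_powersetCard, G.card_neighborFinset_eq_degree, smul_eq_mul]

lemma ite_le_choose (m f : ℕ) : (if m ≤ f then 1 else 0) ≤ f.choose m := by
  split_ifs with h
  · exact Nat.choose_pos h
  · exact Nat.zero_le _

lemma choose_le_ite_add (m f : ℕ) :
    f.choose m ≤ (if m ≤ f then 1 else 0) + (m + 1) * f.choose (m + 1) := by
  rcases lt_trichotomy f m with h | rfl | h
  · simp [Nat.choose_eq_zero_of_lt h]
  · simp
  · rw [mul_comm, Nat.choose_succ_right_eq]
    exact (Nat.le_mul_of_pos_right _ (Nat.sub_pos_of_lt h)).trans (Nat.le_add_left _ _)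

lemma Aset_card_le {V : Type*} [Fintype V] [DecidableEq V] (G : SimpleGraph V)
    [DecidableRel G.Adj] (v : V) (m k : ℕ) :
    #(Aset G m k v) ≤ (G.degree v).choose m * k ^ (Fintype.card V - m) := by
  rw [← sum_friendCount_choose, Aset, card_filter]
  exact sum_le_sum fun σ _ => ite_le_choose m _

lemma le_Aset_card_add {V : Type*} [Fintype V] [DecidableEq V] (G : SimpleGraph V)
    [DecidableRel G.Adj] (v : V) (m k : ℕ) :
    (G.degree v).choose m * k ^ (Fintype.card V - m)
      ≤ #(Aset G m k v)
        + (m + 1) * ((G.degree v).choose (m + 1) * k ^ (Fintype.card V - (m + 1))) := by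
  rw [← sum_friendCount_choose, ← sum_friendCount_choose, Aset, card_filter, mul_sum,
    ← sum_add_distrib]
  exact sum_le_sum fun σ _ => choose_le_ite_add m _

theorem Aset_card_asymptotics {V : Type*} [Fintype V] [DecidableEq V]
    (T : SimpleGraph V) [DecidableRel T.Adj] (hT : T.IsTree) (v : V)
    (n m : ℕ) (hn : Fintype.card V = n) (hm1 : 1 ≤ m) (hmn : m < n) :
    (fun k : ℕ => ((Aset T m k v).card : ℝ)
        - ((T.degree v).choose m : ℝ) * (k : ℝ) ^ (n - m))
      =o[atTop] fun k : ℕ => (k : ℝ) ^ (n - m) := by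
  subst hn
  have hpow : (fun k : ℕ => (k : ℝ) ^ (Fintype.card V - (m + 1)))
      =o[atTop] fun k : ℕ => (k : ℝ) ^ (Fintype.card V - m) :=
    (isLittleO_pow_pow_atTop_of_lt (𝕜 := ℝ) (by omega)).comp_tendsto tendsto_natCast_atTop_atTop
  refine IsBigO.trans_isLittleO
    (IsBigO.of_bound ((m + 1) * (T.degree v).choose (m + 1)) (.of_forall fun k => ?_)) hpow
  have hle : (#(Aset T m k v) : ℝ) ≤ (T.degree v).choose m * (k : ℝ) ^ (Fintype.card V - m) :=
    mod_cast Aset_card_le T v m k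
  have hge : ((T.degree v).choose m : ℝ) * (k : ℝ) ^ (Fintype.card V - m) ≤ #(Aset T m k v)
      + (m + 1) * ((T.degree v).choose (m + 1) * (k : ℝ) ^ (Fintype.card V - (m + 1))) :=
    mod_cast le_Aset_card_add T v m k
  rw [Real.norm_of_nonpos (by linarith), Real.norm_of_nonneg (by positivity)]
  linarith
end

section
/- Let $T$ be a tree with $n$ vertices, let $v$ be a vertex of $T$, and let $l$ be an integer with $0 \le l \le d(v)$. For every positive integer $k$, the number of $k$-colorings of $T$ in which $v$ has exactly $l$ friends equals $\binom{d(v)}{l} \, k \, (k-1)^{d(v)-l} \, k^{\,n-1-d(v)}$. -/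
open Finset Filter Asymptotics

/-- The `k`-colorings in which `v` has color `c` and the set of friends of `v` is `S`. -/
theorem card_colorings_color_eq_friends_eq {V : Type*} [Fintype V] [DecidableEq V]
    (G : SimpleGraph V) [DecidableRel G.Adj] (v : V) {k : ℕ} (c : Fin k) {S : Finset V}
    (hS : S ⊆ G.neighborFinset v) :
    (Finset.univ.filter (fun σ : V → Fin k =>
        σ v = c ∧ (G.neighborFinset v).filter (fun w => σ w = σ v) = S)).card
      = (k - 1) ^ (G.degree v - S.card) * k ^ (Fintype.card V - 1 - G.degree v) := by
  have hv : v ∉ G.neighborFinset v := by simp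
  have hpi : Finset.univ.filter (fun σ : V → Fin k =>
        σ v = c ∧ (G.neighborFinset v).filter (fun w => σ w = σ v) = S)
      = Fintype.piFinset (fun w => if w ∈ G.neighborFinset v \ S then {c}ᶜ
          else if w ∈ (insert v (G.neighborFinset v))ᶜ then Finset.univ else {c}) := by
    ext σ
    simp only [Finset.mem_filter, Finset.mem_univ, true_and, Fintype.mem_piFinset]
    constructor
    · rintro ⟨rfl, h⟩ w
      have hw := Finset.ext_iff.1 h w
      simp only [Finset.mem_filter] at hw
      split_ifs <;> grind [Finset.mem_compl]
    · intro h
      have hc : σ v = c := by simpa [hv] using h v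
      refine ⟨hc, ?_⟩
      ext w
      have hw := h w
      have hSw := @hS w
      rw [Finset.mem_filter, hc]
      split_ifs at hw <;> grind [Finset.mem_compl]
  have hcard : ∀ w, (if w ∈ G.neighborFinset v \ S then ({c}ᶜ : Finset (Fin k))
          else if w ∈ (insert v (G.neighborFinset v))ᶜ then Finset.univ else {c}).card
      = (if w ∈ G.neighborFinset v \ S then k - 1 else 1)
        * (if w ∈ (insert v (G.neighborFinset v))ᶜ then k else 1) := by
    intro w
    split_ifs with h₁ h₂ h₂
    · grind [Finset.mem_compl]
    · simp [Finset.card_compl]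
    · simp
    · simp
  rw [hpi, Fintype.card_piFinset, Finset.prod_congr rfl (fun w _ => hcard w),
    Finset.prod_mul_distrib, Fintype.prod_ite_mem, Fintype.prod_ite_mem, Finset.prod_const,
    Finset.prod_const, Finset.card_sdiff_of_subset hS, Finset.card_compl,
    Finset.card_insert_of_notMem hv, G.card_neighborFinset_eq_degree, Nat.sub_sub,
    Nat.add_comm 1]

theorem card_colorings_exactly_l_friends {V : Type*} [Fintype V] [DecidableEq V]
    (T : SimpleGraph V) [DecidableRel T.Adj] (hT : T.IsTree) (v : V)
    (n l : ℕ) (hn : Fintype.card V = n) (hl : l ≤ T.degree v) (k : ℕ) (hk : 0 < k) :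
    (Finset.univ.filter (fun σ : V → Fin k => friendCount T σ v = l)).card
      = (T.degree v).choose l * k * (k - 1) ^ (T.degree v - l)
        * k ^ (n - 1 - T.degree v) := by
  have hmaps : ∀ σ ∈ Finset.univ.filter (fun σ : V → Fin k => friendCount T σ v = l),
      (σ v, (T.neighborFinset v).filter (fun w => σ w = σ v))
        ∈ (Finset.univ : Finset (Fin k)) ×ˢ (T.neighborFinset v).powersetCard l := by
    intro σ hσ
    exact Finset.mem_product.2 ⟨Finset.mem_univ _,
      Finset.mem_powersetCard.2 ⟨Finset.filter_subset _ _, (Finset.mem_filter.1 hσ).2⟩⟩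
  have hfiber : ∀ p ∈ (Finset.univ : Finset (Fin k)) ×ˢ (T.neighborFinset v).powersetCard l,
      ((Finset.univ.filter (fun σ : V → Fin k => friendCount T σ v = l)).filter
        (fun σ => (σ v, (T.neighborFinset v).filter (fun w => σ w = σ v)) = p)).card
      = (k - 1) ^ (T.degree v - l) * k ^ (n - 1 - T.degree v) := by
    rintro ⟨c, S⟩ hp
    obtain ⟨hS, rfl⟩ := Finset.mem_powersetCard.1 (Finset.mem_product.1 hp).2
    rw [← hn, ← card_colorings_color_eq_friends_eq T v c hS, Finset.filter_filter]
    congr 1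
    ext σ
    simp only [Finset.mem_filter, Finset.mem_univ, true_and, Prod.mk.injEq, friendCount]
    exact ⟨And.right, fun h => ⟨congrArg Finset.card h.2, h⟩⟩
  rw [Finset.card_eq_sum_card_fiberwise hmaps, Finset.sum_congr rfl hfiber, Finset.sum_const,
    Finset.card_product, Finset.card_powersetCard, T.card_neighborFinset_eq_degree,
    Finset.card_univ, Fintype.card_fin, smul_eq_mul]
  ring
end

section
/- Let $G$ be a finite simple graph, let $m \ge 1$ be an integer, and let $v_1, v_2$ be two non-adjacent distinct vertices of $G$. Then for every positive integer $k$, $m \cdot k \cdot |A_{v_1}(k) \cap A_{v_2}(k)| \le d(v_2) \cdot |A_{v_1}(k)|$. -/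
open Finset Filter Asymptotics

theorem sum_sum_update_eq_card_mul_sum {V α : Type*} [Fintype V] [DecidableEq V] [Fintype α]
    (v : V) (g : (V → α) → ℕ) :
    ∑ σ : V → α, ∑ c : α, g (Function.update σ v c) = Fintype.card α * ∑ σ : V → α, g σ := by
  let swap : (V → α) × α → (V → α) × α := fun p => (Function.update p.1 v p.2, p.1 v)
  have hswap : Function.Involutive swap := fun p => by simp [swap]
  calc ∑ σ : V → α, ∑ c : α, g (Function.update σ v c)
      = ∑ p : (V → α) × α, g (swap p).1 := by simp only [Fintype.sum_prod_type, swap]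
    _ = ∑ p : (V → α) × α, g p.1 :=
        Equiv.sum_comp hswap.toPerm (fun p : (V → α) × α => g p.1)
    _ = Fintype.card α * ∑ σ : V → α, g σ := by
        simp [Fintype.sum_prod_type, Finset.mul_sum]

section Friends

variable {V : Type*} [Fintype V] [DecidableEq V] (G : SimpleGraph V) [DecidableRel G.Adj] {k : ℕ}

theorem friendCount_update_of_not_adj {v w : V} (hne : v ≠ w) (hadj : ¬ G.Adj v w)
    (σ : V → Fin k) (c : Fin k) :
    friendCount G (Function.update σ w c) v = friendCount G σ v := by
  unfold friendCount
  congr 1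
  refine Finset.filter_congr fun u hu => ?_
  have huw : u ≠ w := by
    rintro rfl
    exact hadj ((G.mem_neighborFinset v u).1 hu)
  rw [Function.update_of_ne huw, Function.update_of_ne hne]

theorem sum_friendCount_update_self (σ : V → Fin k) (v : V) :
    ∑ c : Fin k, friendCount G (Function.update σ v c) v = G.degree v := by
  rw [← G.card_neighborFinset_eq_degree,
    Finset.card_eq_sum_card_fiberwise (f := σ) (t := Finset.univ) (by simp)]
  refine Finset.sum_congr rfl fun c _ => ?_
  unfold friendCount
  congr 1
  refine Finset.filter_congr fun u hu => ?_
  have huv : u ≠ v := ((G.mem_neighborFinset v u).1 hu).ne'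
  rw [Function.update_of_ne huv, Function.update_self]

theorem update_mem_Aset_iff_of_not_adj {m : ℕ} {v w : V} (hne : v ≠ w) (hadj : ¬ G.Adj v w)
    (σ : V → Fin k) (c : Fin k) :
    Function.update σ w c ∈ Aset G m k v ↔ σ ∈ Aset G m k v := by
  simp [Aset, friendCount_update_of_not_adj G hne hadj]

theorem mul_sum_friendCount_Aset_of_not_adj (m : ℕ) {v w : V} (hne : v ≠ w)
    (hadj : ¬ G.Adj v w) :
    k * ∑ σ ∈ Aset G m k v, friendCount G σ w = G.degree w * (Aset G m k v).card := by
  have h := sum_sum_update_eq_card_mul_sum w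
    fun σ : V → Fin k => if σ ∈ Aset G m k v then friendCount G σ w else 0
  simp only [update_mem_Aset_iff_of_not_adj G hne hadj, Fintype.card_fin, Finset.sum_ite_mem,
    Finset.univ_inter] at h
  rw [← h, mul_comm, ← smul_eq_mul, ← Finset.sum_const, ← Finset.univ_inter (Aset G m k v),
    ← Finset.sum_ite_mem, Finset.univ_inter]
  refine Finset.sum_congr rfl fun σ _ => ?_
  split_ifs
  · exact sum_friendCount_update_self G σ w
  · simp

end Friends

theorem inter_card_le_of_not_adjacent {V : Type*} [Fintype V] [DecidableEq V]
    (G : SimpleGraph V) [DecidableRel G.Adj]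
    (m : ℕ) (hm : 1 ≤ m) (v₁ v₂ : V) (hne : v₁ ≠ v₂) (hadj : ¬ G.Adj v₁ v₂)
    (k : ℕ) (hk : 0 < k) :
    m * k * (Aset G m k v₁ ∩ Aset G m k v₂).card
      ≤ G.degree v₂ * (Aset G m k v₁).card := by
  calc m * k * (Aset G m k v₁ ∩ Aset G m k v₂).card
      = k * ∑ _σ ∈ Aset G m k v₁ ∩ Aset G m k v₂, m := by
        rw [Finset.sum_const, smul_eq_mul]; ring
    _ ≤ k * ∑ σ ∈ Aset G m k v₁ ∩ Aset G m k v₂, friendCount G σ v₂ := by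
        gcongr with σ hσ
        exact (Finset.mem_filter.1 (Finset.mem_inter.1 hσ).2).2
    _ ≤ k * ∑ σ ∈ Aset G m k v₁, friendCount G σ v₂ := by
        gcongr
        exact Finset.inter_subset_left
    _ = G.degree v₂ * (Aset G m k v₁).card :=
        mul_sum_friendCount_Aset_of_not_adj G m hne hadj
end

section
/- Let $T$ be a tree, let $m \ge 2$ be an integer, and let $v_1, v_2$ be adjacent vertices of $T$. Then for every positive integer $k$, $k \cdot |A_{v_1}(k) \cap A_{v_2}(k)| \le 2^{d(v_2)-1} \cdot |A_{v_1}(k)|$. -/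
open Finset Filter Asymptotics

/-- Changing the colors away from a vertex and its neighbors preserves its number of friends. -/
theorem friendCount_congr {V : Type*} [Fintype V] (G : SimpleGraph V) [DecidableRel G.Adj]
    {k : ℕ} {σ τ : V → Fin k} {v : V} (hv : σ v = τ v) (h : ∀ w, G.Adj v w → σ w = τ w) :
    friendCount G σ v = friendCount G τ v := by
  unfold friendCount
  congr 1
  refine Finset.filter_congr fun w hw => ?_
  rw [h w ((G.mem_neighborFinset v w).1 hw), hv]

theorem inter_card_le_of_adjacent {V : Type*} [Fintype V] [DecidableEq V]
    (T : SimpleGraph V) [DecidableRel T.Adj] (hT : T.IsTree)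
    (m : ℕ) (hm : 2 ≤ m) (v₁ v₂ : V) (hadj : T.Adj v₁ v₂)
    (k : ℕ) (hk : 0 < k) :
    k * (Aset T m k v₁ ∩ Aset T m k v₂).card
      ≤ 2 ^ (T.degree v₂ - 1) * (Aset T m k v₁).card := by
  let S := (T.neighborFinset v₂).erase v₁
  let F : (V → Fin k) → Finset V := fun σ => S.filter (fun w => σ w = σ v₂)
  -- Recolor the friends of `v₂` other than `v₁` with `c`, remembering which they were.
  let f : Fin k × (V → Fin k) → Finset V × (V → Fin k) :=
    fun x => (F x.2, fun w => if w ∈ F x.2 then x.1 else x.2 w)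
  have mem_F (σ : V → Fin k) (w : V) :
      w ∈ F σ ↔ (w ≠ v₁ ∧ T.Adj v₂ w) ∧ σ w = σ v₂ := by simp [F, S]
  have v₂_notMem (σ : V → Fin k) : v₂ ∉ F σ := by simp [mem_F]
  have hS : S.card = T.degree v₂ - 1 := by
    rw [Finset.card_erase_of_mem (by simpa using hadj.symm), T.card_neighborFinset_eq_degree]
  have hcard := Finset.card_le_card_of_injOn
    (s := (Finset.univ : Finset (Fin k)) ×ˢ (Aset T m k v₁ ∩ Aset T m k v₂))
    (t := S.powerset ×ˢ Aset T m k v₁) f ?_ ?_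
  · simpa [Finset.card_product, hS] using hcard
  · rintro ⟨c, σ⟩ hσ
    have hσ₁ : m ≤ friendCount T σ v₁ := by
      have h : m ≤ friendCount T σ v₁ ∧ m ≤ friendCount T σ v₂ := by simpa [Aset] using hσ
      exact h.1
    have heq : friendCount T (f (c, σ)).2 v₁ = friendCount T σ v₁ := by
      refine friendCount_congr T ?_ fun w hw => ?_
      · exact if_neg (by simp [mem_F])
      · refine if_neg fun hwF => ?_
        exact hT.isAcyclic.cliqueFree le_rfl {v₁, v₂, w}
          (SimpleGraph.is3Clique_triple_iff.2 ⟨hadj, hw, ((mem_F σ w).1 hwF).1.2⟩)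
    simp only [Finset.coe_product, Set.mem_prod, Finset.mem_coe, Finset.mem_powerset]
    exact ⟨Finset.filter_subset _ _, by simpa [Aset, heq] using hσ₁⟩
  · rintro ⟨c, σ⟩ hσ ⟨c', τ⟩ - h
    have hF : F σ = F τ := congrArg Prod.fst h
    have hval (w : V) : (if w ∈ F σ then c else σ w) = if w ∈ F σ then c' else τ w := by
      have := congrFun (congrArg Prod.snd h) w
      simpa only [f, ← hF] using this
    have h₂ : σ v₂ = τ v₂ := by simpa [v₂_notMem] using hval v₂
    have hσ₂ : m ≤ friendCount T σ v₂ := by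
      have h : m ≤ friendCount T σ v₁ ∧ m ≤ friendCount T σ v₂ := by simpa [Aset] using hσ
      exact h.2
    obtain ⟨w, hw, hne⟩ := Finset.exists_mem_ne (lt_of_lt_of_le hm hσ₂) v₁
    have hwF : w ∈ F σ := by
      rw [mem_F]
      simpa [hne] using hw
    have hc : c = c' := by simpa [hwF] using hval w
    refine Prod.ext hc (funext fun u => ?_)
    by_cases hu : u ∈ F σ
    · have hu' := hF ▸ hu
      change σ u = τ u
      rw [((mem_F σ u).1 hu).2, ((mem_F τ u).1 hu').2, h₂]
    · simpa [hu] using hval u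
end

section
/- Let $T$ be a tree with $n$ vertices, let $m$ be an integer with $1 < m < n$, and let $v_1, v_2$ be two distinct vertices of $T$. Then $|A_{v_1}(k) \cap A_{v_2}(k)| = o(k^{n-m})$ as $k \to \infty$. -/
open Finset Filter Asymptotics

/-- In an acyclic graph, at most one neighbor of `v` lies in the closed neighborhood of `u ≠ v`. -/
theorem SimpleGraph.IsAcyclic.eq_of_adj_of_mem_closed_neighborhood {V : Type*}
    {G : SimpleGraph V} (hG : G.IsAcyclic) {u v a b : V} (huv : u ≠ v)
    (hav : G.Adj a v) (hbv : G.Adj b v) (ha : a = u ∨ G.Adj u a) (hb : b = u ∨ G.Adj u b) :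
    a = b := by
  have exists_path : ∀ c, G.Adj c v → (c = u ∨ G.Adj u c) →
      ∃ p : G.Path u v, p.1.penultimate = c := by
    rintro c hcv (rfl | huc)
    · exact ⟨⟨hcv.toWalk, by simp [hcv.ne]⟩, by simp⟩
    · refine ⟨⟨.cons huc (.cons hcv .nil), ?_⟩, by simp⟩
      simp [SimpleGraph.Walk.cons_isPath_iff, hcv.ne, huc.ne, huv]
  obtain ⟨p, rfl⟩ := exists_path a hav ha
  obtain ⟨q, rfl⟩ := exists_path b hbv hb
  rw [(hG.subsingleton_path u v).elim p q]

/-- Functions that are pairwise determined by their values off `R` number at most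
`k ^ (|V| - |R|)`. -/
theorem card_le_pow_of_eqOn_compl_imp_eq {V : Type*} [Fintype V] [DecidableEq V] {k : ℕ}
    (R : Finset V) (A : Finset (V → Fin k))
    (h : ∀ σ ∈ A, ∀ τ ∈ A, (∀ x ∉ R, σ x = τ x) → σ = τ) :
    A.card ≤ k ^ (Fintype.card V - R.card) := by
  have hcard : Fintype.card ({x // x ∉ R} → Fin k) = k ^ (Fintype.card V - R.card) := by
    simp [Fintype.card_subtype_compl]
  rw [← hcard, ← Finset.card_univ]
  refine Finset.card_le_card_of_injOn (fun σ x => σ x.1) (by simp) fun σ hσ τ hτ hst => ?_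
  exact h σ hσ τ hτ fun x hx => congrFun hst ⟨x, hx⟩

theorem card_inter_Aset_le {V : Type*} [Fintype V] [DecidableEq V]
    (G : SimpleGraph V) [DecidableRel G.Adj] (hG : G.IsAcyclic) {m : ℕ} (hm : 1 < m) (k : ℕ)
    {u v : V} (huv : u ≠ v) :
    (Aset G m k u ∩ Aset G m k v).card ≤
      Fintype.card (Finset V × V) * k ^ (Fintype.card V - (m + 1)) := by
  let P : Finset V × V → Finset (V → Fin k) := fun p => Finset.univ.filter fun σ =>
    p.1.card = m ∧ u ∉ p.1 ∧ p.2 ∉ p.1 ∧ p.2 ≠ u ∧ p.2 ≠ v ∧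
      (∀ x ∈ p.1, σ x = σ u) ∧ σ p.2 = σ v
  have hsub : Aset G m k u ∩ Aset G m k v ⊆ Finset.univ.biUnion P := by
    intro σ hσ
    simp only [Aset, Finset.mem_inter, Finset.mem_filter, Finset.mem_univ, true_and] at hσ
    unfold friendCount at hσ
    obtain ⟨S, hS, hSm⟩ := Finset.exists_subset_card_eq hσ.1
    obtain ⟨a, ha, b, hb, hab⟩ := Finset.one_lt_card.1 (hm.trans_le hσ.2)
    simp only [Finset.mem_filter, SimpleGraph.mem_neighborFinset] at ha hb
    obtain ⟨w, hw, hwu, hw'⟩ : ∃ w, (G.Adj v w ∧ σ w = σ v) ∧ w ≠ u ∧ ¬ G.Adj u w := by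
      by_contra! hcon
      exact hab (hG.eq_of_adj_of_mem_closed_neighborhood huv ha.1.symm hb.1.symm
        (or_iff_not_imp_left.2 (hcon a ha)) (or_iff_not_imp_left.2 (hcon b hb)))
    have hS' : ∀ x ∈ S, G.Adj u x ∧ σ x = σ u := fun x hx => by simpa using hS hx
    simp only [Finset.mem_biUnion, Finset.mem_univ, true_and, P, Finset.mem_filter]
    exact ⟨(S, w), hSm, fun h => G.irrefl (hS' u h).1, fun h => hw' (hS' w h).1, hwu,
      hw.1.ne', fun x hx => (hS' x hx).2, hw.2⟩
  refine (Finset.card_le_card hsub).trans ?_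
  rw [← Finset.card_univ]
  refine Finset.card_biUnion_le_card_mul _ _ _ fun ⟨S, w⟩ _ => ?_
  by_cases hS : S.card = m ∧ w ∉ S
  · rw [← hS.1, ← Finset.card_insert_of_notMem hS.2]
    refine card_le_pow_of_eqOn_compl_imp_eq _ _ fun σ hσ τ hτ h => ?_
    simp only [P, Finset.mem_filter, Finset.mem_univ, true_and] at hσ hτ
    obtain ⟨-, huS, -, hwu, hwv, hσS, hσw⟩ := hσ
    obtain ⟨-, -, -, -, -, hτS, hτw⟩ := hτ
    have hu : σ u = τ u := h u (by simp [huS, hwu.symm])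
    have hne : ∀ x, x ≠ w → σ x = τ x := fun x hx => by
      by_cases hxS : x ∈ S
      · rw [hσS x hxS, hτS x hxS, hu]
      · exact h x (by simp [hx, hxS])
    funext x
    rcases eq_or_ne x w with rfl | hx
    · rw [hσw, hτw, hne v hwv.symm]
    · exact hne x hx
  · have hP : P (S, w) = ∅ := Finset.filter_eq_empty_iff.2 fun σ _ h => hS ⟨h.1, h.2.2.1⟩
    simp [hP]

theorem inter_card_isLittleO {V : Type*} [Fintype V] [DecidableEq V]
    (T : SimpleGraph V) [DecidableRel T.Adj] (hT : T.IsTree)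
    (n m : ℕ) (hn : Fintype.card V = n) (hm1 : 1 < m) (hmn : m < n)
    (v₁ v₂ : V) (hne : v₁ ≠ v₂) :
    (fun k : ℕ => ((Aset T m k v₁ ∩ Aset T m k v₂).card : ℝ))
      =o[atTop] fun k : ℕ => (k : ℝ) ^ (n - m) := by
  subst hn
  have hO : (fun k : ℕ => ((Aset T m k v₁ ∩ Aset T m k v₂).card : ℝ))
      =O[atTop] fun k : ℕ => (k : ℝ) ^ (Fintype.card V - (m + 1)) := by
    refine IsBigO.of_bound (Fintype.card (Finset V × V)) (Eventually.of_forall fun k => ?_)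
    rw [Real.norm_of_nonneg (by positivity), Real.norm_of_nonneg (by positivity)]
    exact_mod_cast card_inter_Aset_le T hT.isAcyclic hm1 k hne
  have ho := isLittleO_pow_pow_atTop_of_lt (𝕜 := ℝ)
    (show Fintype.card V - (m + 1) < Fintype.card V - m by omega)
  exact hO.trans_isLittleO (ho.comp_tendsto tendsto_natCast_atTop_atTop)
end

section
/- Let $T$ be a tree with $n$ vertices, let $m$ be an integer with $1 < m < n$, and let $S$ be a set of vertices of $T$ with $|S| \ge 2$. Then $\left|\bigcap_{v \in S} A_v(k)\right| = o(k^{n-m})$ as $k \to \infty$. -/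
open Finset Filter Asymptotics

/-- A tree rooted at `u` has a parent function `p` and a depth function `d`: parents have smaller
depth, and of two adjacent vertices one is the parent of the other. -/
lemma SimpleGraph.IsTree.exists_parent {V : Type*} {T : SimpleGraph V} (hT : T.IsTree) (u : V) :
    ∃ (p : V → V) (d : V → ℕ), (∀ w, w ≠ u → d (p w) < d w) ∧
      ∀ a b, T.Adj a b → (b ≠ u ∧ p b = a) ∨ (a ≠ u ∧ p a = b) := by
  choose f hf using fun w => hT.connected.exists_isPath u w
  have concat_of_mem : ∀ a b (h : T.Adj a b), a ∈ (f b).support → f b = (f a).concat h :=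
    fun a b h ha => hT.isAcyclic.path_concat (hf a) (hf b) h ha
  have eq_parent : ∀ a b, T.Adj a b → a ∈ (f b).support → b ≠ u ∧ (f b).penultimate = a := by
    intro a b h ha
    have hc := concat_of_mem a b h ha
    refine ⟨?_, by rw [hc, SimpleGraph.Walk.penultimate_concat]⟩
    rintro rfl
    have hnil := (SimpleGraph.Walk.isPath_iff_nil.mp (hf b)).eq_nil
    have := congrArg SimpleGraph.Walk.length (hnil.symm.trans hc)
    simp at this
  refine ⟨fun w => (f w).penultimate, fun w => (f w).length, fun w hw => ?_, fun a b h => ?_⟩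
  · have hnil : ¬ (f w).Nil := SimpleGraph.Walk.not_nil_of_ne hw.symm
    have := congrArg SimpleGraph.Walk.length
      (concat_of_mem _ w ((f w).adj_penultimate hnil) ((f w).getVert_mem_support _))
    rw [SimpleGraph.Walk.length_concat] at this
    lia
  · by_cases ha : a ∈ (f b).support
    · exact Or.inl (eq_parent a b h ha)
    · exact Or.inr (eq_parent b a h.symm
        (hT.isAcyclic.mem_support_of_ne_mem_support_of_adj_of_isPath (hf a) (hf b) h ha))

/-- If `d` strictly decreases along `p` off the root `u`, a function is determined by the set of
non-root points where it agrees with its value at the parent, and its values elsewhere. -/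
lemma eq_of_eq_parent {V α : Type*} {u : V} {p : V → V} {d : V → ℕ}
    (hd : ∀ w, w ≠ u → d (p w) < d w) {σ τ : V → α}
    (hW : ∀ w, w ≠ u → (σ w = σ (p w) ↔ τ w = τ (p w)))
    (hoff : ∀ w, ¬ (w ≠ u ∧ σ w = σ (p w)) → σ w = τ w) : σ = τ := by
  funext w
  induction h : d w using Nat.strong_induction_on generalizing w with
  | _ N ih =>
    by_cases hw : w ≠ u ∧ σ w = σ (p w)
    · rw [hw.2, (hW w hw.1).mp hw.2]
      exact ih _ (h ▸ hd w hw.1) _ rfl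
    · exact hoff w hw

/-- Few colorings agree with the parent's color at `r` or more non-root vertices. -/
lemma card_filter_eq_parent_le {V : Type*} [Fintype V] [DecidableEq V] {u : V} {p : V → V}
    {d : V → ℕ} (hd : ∀ w, w ≠ u → d (p w) < d w) (r k : ℕ) (hk : 0 < k) :
    (univ.filter (fun σ : V → Fin k =>
      r ≤ (univ.filter (fun w => w ≠ u ∧ σ w = σ (p w))).card)).card ≤
      2 ^ Fintype.card V * k ^ (Fintype.card V - r) := by
  have hfib : ∀ W ∈ (univ : Finset (Finset V)).filter (r ≤ #·),
      ((univ.filter (fun σ : V → Fin k =>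
        r ≤ (univ.filter (fun w => w ≠ u ∧ σ w = σ (p w))).card)).filter
        (fun σ => univ.filter (fun w => w ≠ u ∧ σ w = σ (p w)) = W)).card ≤
      k ^ (Fintype.card V - r) := by
    intro W hW
    calc _ ≤ (univ : Finset ({w // w ∈ Wᶜ} → Fin k)).card := by
          refine card_le_card_of_injOn (fun σ w => σ w) (fun _ _ => mem_coe.mpr (mem_univ _)) ?_
          intro σ hσ τ hτ h
          have hσW := (mem_filter.mp (mem_coe.mp hσ)).2
          have hτW := (mem_filter.mp (mem_coe.mp hτ)).2
          refine eq_of_eq_parent hd (fun w hw => ?_) (fun w hw => ?_)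
          · have := Finset.ext_iff.mp (hσW.trans hτW.symm) w
            simpa [hw] using this
          · have hwW : w ∈ Wᶜ := by
              rw [← hσW]
              simpa using hw
            exact congrFun h ⟨w, hwW⟩
      _ = k ^ (Fintype.card V - #W) := by simp
      _ ≤ _ := Nat.pow_le_pow_right hk (Nat.sub_le_sub_left (mem_filter.mp hW).2 _)
  calc _ ≤ k ^ (Fintype.card V - r) * #((univ : Finset (Finset V)).filter (r ≤ #·)) :=
        card_le_mul_card_image_of_maps_to (fun σ hσ => by simpa using hσ) _ hfib
    _ ≤ k ^ (Fintype.card V - r) * 2 ^ Fintype.card V := by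
        gcongr
        exact (card_filter_le _ _).trans (by simp)
    _ = _ := mul_comm _ _

/-- If `u ≠ v` both have at least `m ≥ 2` friends, then at least `m + 1` vertices share the color
of their parent in the tree rooted at `u`. -/
lemma succ_le_card_eq_parent {V : Type*} [Fintype V] [DecidableEq V] {T : SimpleGraph V}
    [DecidableRel T.Adj] {u v : V} (huv : u ≠ v) {p : V → V}
    (hp : ∀ a b, T.Adj a b → (b ≠ u ∧ p b = a) ∨ (a ≠ u ∧ p a = b))
    {m k : ℕ} (hm : 1 < m) {σ : V → Fin k}
    (hu : m ≤ friendCount T σ u) (hv : m ≤ friendCount T σ v) :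
    m + 1 ≤ (univ.filter (fun w => w ≠ u ∧ σ w = σ (p w))).card := by
  unfold friendCount at hu hv
  set A := (T.neighborFinset u).filter (fun w => σ w = σ u) with hA
  set B := (T.neighborFinset v).filter (fun w => σ w = σ v) with hB
  have hAp : ∀ w ∈ A, w ≠ u ∧ p w = u ∧ σ w = σ u := by
    intro w hw
    simp only [hA, mem_filter, SimpleGraph.mem_neighborFinset] at hw
    have := hp u w hw.1
    tauto
  have hBp : ∀ w ∈ B.erase (p v), w ≠ u ∧ p w = v ∧ σ w = σ v := by
    intro w hw
    simp only [hB, mem_erase, mem_filter, SimpleGraph.mem_neighborFinset] at hw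
    have := hp v w hw.2.1
    grind
  have hdisj : Disjoint A (B.erase (p v)) :=
    disjoint_left.mpr fun w h₁ h₂ => huv ((hAp w h₁).2.1.symm.trans (hBp w h₂).2.1)
  have hsub : A ∪ B.erase (p v) ⊆ univ.filter (fun w => w ≠ u ∧ σ w = σ (p w)) := by
    intro w hw
    rw [mem_filter]
    rcases mem_union.mp hw with h | h
    · obtain ⟨h₁, h₂, h₃⟩ := hAp w h
      exact ⟨mem_univ _, h₁, by rw [h₂, h₃]⟩
    · obtain ⟨h₁, h₂, h₃⟩ := hBp w h
      exact ⟨mem_univ _, h₁, by rw [h₂, h₃]⟩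
  have hcard := card_le_card hsub
  rw [card_union_of_disjoint hdisj] at hcard
  have := pred_card_le_card_erase (s := B) (a := p v)
  lia

theorem iInter_card_isLittleO {V : Type*} [Fintype V] [DecidableEq V]
    (T : SimpleGraph V) [DecidableRel T.Adj] (hT : T.IsTree)
    (n m : ℕ) (hn : Fintype.card V = n) (hm1 : 1 < m) (hmn : m < n)
    (S : Finset V) (hS : 2 ≤ S.card) :
    (fun k : ℕ =>
        ((Finset.univ.filter (fun σ : V → Fin k =>
            ∀ v ∈ S, σ ∈ Aset T m k v)).card : ℝ))
      =o[atTop] fun k : ℕ => (k : ℝ) ^ (n - m) := by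
  obtain ⟨u, hu, v, hv, huv⟩ := one_lt_card.mp hS
  obtain ⟨p, d, hd, hp⟩ := hT.exists_parent u
  have hO : (fun k : ℕ => ((univ.filter (fun σ : V → Fin k =>
      ∀ v ∈ S, σ ∈ Aset T m k v)).card : ℝ)) =O[atTop]
      fun k : ℕ => (k : ℝ) ^ (n - (m + 1)) := by
    refine IsBigO.of_bound (2 ^ n) ?_
    filter_upwards [eventually_gt_atTop 0] with k hk
    have hle : (univ.filter (fun σ : V → Fin k => ∀ v ∈ S, σ ∈ Aset T m k v)).card ≤
        2 ^ n * k ^ (n - (m + 1)) := by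
      rw [← hn]
      refine (card_le_card fun σ hσ => ?_).trans (card_filter_eq_parent_le hd (m + 1) k hk)
      have hmem := (mem_filter.mp hσ).2
      exact mem_filter.mpr ⟨mem_univ _, succ_le_card_eq_parent huv hp hm1
        (mem_filter.mp (hmem u hu)).2 (mem_filter.mp (hmem v hv)).2⟩
    rw [Real.norm_of_nonneg (by positivity), Real.norm_of_nonneg (by positivity)]
    exact_mod_cast hle
  refine hO.trans_isLittleO ?_
  exact (isLittleO_pow_pow_atTop_of_lt (𝕜 := ℝ) (by lia)).comp_tendsto
    tendsto_natCast_atTop_atTop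
end
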